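/- Let O be a finite set of objects and let there be n ≥ 2 agents, where each agent i ∈ {1, …, n} has an additive valuation V_i : 2^O → ℝ≥0 (so V_i(A ∪ B) = V_i(A) + V_i(B) for disjoint A, B ⊆ O). Then there exists a partition of the entire set O into n pairwise-disjoint bundles Z_1 ⊔ ⋯ ⊔ Z_n = O such that for every agent i: V_i(Z_i) ≥ MMS_i^{1,2n−2}(O). -/

import Mathlib

/-- The `l`-out-of-`d` maximin share of an agent with valuation `Vi` over the whole
finite set of objects `α`: the maximum, over all partitions of the objects into `d`
pairwise-disjoint subsets, of the minimum, over all unions of `l` of the subsets,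
of the value of that union. -/
noncomputable def MMS {α : Type*} [Fintype α] [DecidableEq α]
    (Vi : Finset α → ℝ) (l d : ℕ) : ℝ :=
  sSup { t : ℝ | ∃ P : Fin d → Finset α,
    (∀ i j, i ≠ j → Disjoint (P i) (P j)) ∧
    Finset.univ.biUnion P = Finset.univ ∧
    t = sInf { u : ℝ | ∃ S : Finset (Fin d), S.card = l ∧ u = Vi (S.biUnion P) } }

/-- The maximin share is nonnegative, and some partition attains it: every part is worth at
least the share. -/
lemma MMS_one_attained {α : Type*} [Fintype α] [DecidableEq α] {V : Finset α → ℝ}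
    (hV : ∀ A, 0 ≤ V A) {d : ℕ} (hd : 0 < d) :
    0 ≤ MMS V 1 d ∧ ∃ P : Fin d → Finset α, (∀ i j, i ≠ j → Disjoint (P i) (P j)) ∧
      Finset.univ.biUnion P = Finset.univ ∧ ∀ k, MMS V 1 d ≤ V (P k) := by
  have hmem : MMS V 1 d ∈ { t : ℝ | ∃ P : Fin d → Finset α,
      (∀ i j, i ≠ j → Disjoint (P i) (P j)) ∧ Finset.univ.biUnion P = Finset.univ ∧
      t = sInf { u : ℝ | ∃ S : Finset (Fin d), S.card = 1 ∧ u = V (S.biUnion P) } } := by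
    apply Set.Nonempty.csSup_mem
    · refine ⟨_, fun k => if k = ⟨0, hd⟩ then Finset.univ else ∅, ?_, ?_, rfl⟩
      · intro i j hij
        by_cases hi : i = ⟨0, hd⟩
        · have hj : j ≠ ⟨0, hd⟩ := fun h => hij (hi.trans h.symm)
          simp [hj]
        · simp [hi]
      · refine Finset.eq_univ_of_forall fun a => Finset.mem_biUnion.2 ⟨⟨0, hd⟩, ?_⟩
        simp
    · refine (Set.finite_range fun P : Fin d → Finset α =>
        sInf { u : ℝ | ∃ S : Finset (Fin d), S.card = 1 ∧ u = V (S.biUnion P) }).subset ?_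
      rintro t ⟨P, -, -, rfl⟩
      exact ⟨P, rfl⟩
  obtain ⟨P, hdisj, hcover, ht⟩ := hmem
  refine ⟨?_, P, hdisj, hcover, fun k => ?_⟩
  · rw [ht]
    apply Real.sInf_nonneg
    rintro u ⟨S, -, rfl⟩
    exact hV _
  · rw [ht]
    refine csInf_le ⟨0, ?_⟩ ⟨{k}, by simp, by simp⟩
    rintro u ⟨S, -, rfl⟩
    exact hV _

/-- If every part of a partition has weight at least `t`, the weights can be lowered so that
every part has weight exactly `t`. -/
lemma exists_weight_le_sum_part_eq {α κ : Type*} [Fintype α] [DecidableEq α] [Fintype κ]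
    {v : α → ℝ} (hv : ∀ a, 0 ≤ v a) {t : ℝ} (ht : 0 ≤ t) {P : κ → Finset α}
    (hdisj : ∀ i j, i ≠ j → Disjoint (P i) (P j)) (hcover : Finset.univ.biUnion P = Finset.univ)
    (hP : ∀ k, t ≤ ∑ a ∈ P k, v a) :
    ∃ w : α → ℝ, (∀ a, 0 ≤ w a) ∧ (∀ a, w a ≤ v a) ∧ ∀ k, ∑ a ∈ P k, w a = t := by
  have hpart : ∀ a, ∃ k, a ∈ P k := fun a => by
    have := Finset.mem_univ a
    rw [← hcover] at this
    simpa using this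
  choose p hp using hpart
  refine ⟨fun a => v a * (t / ∑ b ∈ P (p a), v b), fun a => ?_, fun a => ?_, fun k => ?_⟩
  · exact mul_nonneg (hv a) (div_nonneg ht (Finset.sum_nonneg fun b _ => hv b))
  · exact mul_le_of_le_one_right (hv a) (div_le_one_of_le₀ (hP _) (ht.trans (hP _)))
  · have hpk : ∀ a ∈ P k, p a = k := fun a ha => by
      by_contra hne
      exact Finset.disjoint_left.1 (hdisj _ _ hne) (hp a) ha
    have hcongr : ∀ a ∈ P k, v a * (t / ∑ b ∈ P (p a), v b) = v a * (t / ∑ b ∈ P k, v b) :=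
      fun a ha => by rw [hpk a ha]
    rw [Finset.sum_congr rfl hcongr, ← Finset.sum_mul]
    rcases ht.eq_or_lt with rfl | hpos
    · simp
    · exact mul_div_cancel₀ _ (hpos.trans_le (hP k)).ne'

/-- Bag filling: if each of `m` agents values the objects of `R` at `2 m - 1` times its
threshold or more, and each single object at no more than its threshold, then disjoint subsets
of `R` satisfy all the agents. -/
lemma exists_bag_filling {α ι : Type*} [DecidableEq α] [DecidableEq ι] {w : ι → α → ℝ}
    {t : ι → ℝ} (ht : ∀ i, 0 ≤ t i) (hwt : ∀ i a, w i a ≤ t i)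
    (A : Finset ι) (R : Finset α) (hR : ∀ i ∈ A, (2 * (A.card : ℝ) - 1) * t i ≤ ∑ a ∈ R, w i a) :
    ∃ Z : ι → Finset α, (∀ i ∈ A, ∀ j ∈ A, i ≠ j → Disjoint (Z i) (Z j)) ∧
      (∀ i, Z i ⊆ R) ∧ ∀ i ∈ A, t i ≤ ∑ a ∈ Z i, w i a := by
  induction hm : A.card generalizing A R with
  | zero =>
    rw [Finset.card_eq_zero] at hm
    subst hm
    exact ⟨fun _ => ∅, by simp, by simp, by simp⟩
  | succ m ih =>
    rw [hm] at hR
    push_cast at hR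
    have hm0 : (0 : ℝ) ≤ m := m.cast_nonneg
    obtain ⟨i₀, hi₀⟩ : A.Nonempty := Finset.card_pos.1 (by omega)
    have hsat : ∃ i ∈ A, t i ≤ ∑ a ∈ R, w i a :=
      ⟨i₀, hi₀, by nlinarith [hR i₀ hi₀, ht i₀, mul_nonneg hm0 (ht i₀)]⟩
    obtain ⟨B, hBR, hBmin⟩ := Finite.exists_le_minimal (α := {S : Finset α // S ⊆ R})
      (p := fun S => ∃ i ∈ A, t i ≤ ∑ a ∈ S.1, w i a) (a := ⟨R, subset_rfl⟩) hsat
    obtain ⟨B, hBR⟩ := B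
    obtain ⟨i, hiA, hiB⟩ := hBmin.prop
    have hB2 : ∀ j ∈ A, ∑ a ∈ B, w j a ≤ 2 * t j := fun j hj => by
      rcases B.eq_empty_or_nonempty with rfl | ⟨b, hb⟩
      · simpa using ht j
      · have hlt : ∑ a ∈ B.erase b, w j a < t j := by
          by_contra! hge
          have := hBmin.le_of_le (y := ⟨B.erase b, (B.erase_subset b).trans hBR⟩) ⟨j, hj, hge⟩
            (B.erase_subset b)
          exact Finset.notMem_erase b B (this hb)
        rw [← Finset.add_sum_erase B _ hb]
        linarith [hwt j b]
    obtain ⟨Z, hZdisj, hZR, hZ⟩ := ih (A.erase i) (R \ B) (fun j hj => by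
      have hjA := Finset.mem_of_mem_erase hj
      have hcard : (A.erase i).card = m := by rw [Finset.card_erase_of_mem hiA, hm]; rfl
      have := Finset.sum_sdiff hBR (f := w j)
      rw [hcard]
      nlinarith [hR j hjA, hB2 j hjA]) (by rw [Finset.card_erase_of_mem hiA, hm]; rfl)
    have hBZ : ∀ j, Disjoint B (Z j) := fun j =>
      Finset.disjoint_of_subset_right (hZR j) Finset.disjoint_sdiff
    refine ⟨Function.update Z i B, fun j hj k hk hjk => ?_, fun j => ?_, fun j hj => ?_⟩
    · by_cases hji : j = i
      · subst hji
        simpa [Function.update_of_ne hjk.symm] using hBZ k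
      by_cases hki : k = i
      · subst hki
        simpa [Function.update_of_ne hjk] using (hBZ j).symm
      · simpa [hji, hki] using hZdisj j (Finset.mem_erase.2 ⟨hji, hj⟩) k
          (Finset.mem_erase.2 ⟨hki, hk⟩) hjk
    · by_cases hji : j = i
      · subst hji
        simpa using hBR
      · simpa [hji] using (hZR j).trans Finset.sdiff_subset
    · by_cases hji : j = i
      · subst hji
        simpa using hiB
      · simpa [hji] using hZ j (Finset.mem_erase.2 ⟨hji, hj⟩)

/-- Envy-free matching: if the vertex `d` is adjacent to everything, then all vertices outside
some set `A` not containing `d` can be matched to distinct non-neighbours of `A`. -/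
lemma exists_envy_free_matching {ι κ : Type*} [Fintype ι] [DecidableEq ι] [Fintype κ]
    [DecidableEq κ] (hcard : Fintype.card ι ≤ Fintype.card κ) (N : ι → Finset κ) (d : ι)
    (hd : N d = Finset.univ) :
    ∃ (A : Finset ι) (f : {i // i ∉ A} → κ), d ∉ A ∧ Function.Injective f ∧
      ∀ i : {i // i ∉ A}, f i ∈ N i ∧ ∀ j ∈ A, f i ∉ N j := by
  obtain ⟨A, hA, hmax⟩ := (Finset.univ.erase d).powerset.exists_max_image
    (fun A => (A.card : ℤ) - (A.biUnion N).card) ⟨∅, by simp⟩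
  have hdA : d ∉ A := fun h => by simpa using Finset.mem_powerset.1 hA h
  have hdef : (A.biUnion N).card ≤ A.card := by
    have := hmax ∅ (by simp)
    simp at this
    omega
  have hall : ∀ S : Finset {i // i ∉ A}, S.card ≤ (S.biUnion fun i => N i \ A.biUnion N).card := by
    intro S
    set C : Finset ι := S.map (Function.Embedding.subtype _) with hC
    have hCcard : C.card = S.card := Finset.card_map _
    have hAC : Disjoint A C := by
      rw [Finset.disjoint_left]
      intro a ha haC
      obtain ⟨b, -, rfl⟩ := Finset.mem_map.1 haC
      exact b.2 ha
    have hunion : (A ∪ C).biUnion N =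
        A.biUnion N ∪ S.biUnion fun i => N i \ A.biUnion N := by
      ext k
      simp only [hC, Finset.mem_biUnion, Finset.mem_union, Finset.mem_map, Finset.mem_sdiff,
        Function.Embedding.subtype_apply]
      constructor
      · rintro ⟨i, hi | ⟨b, hb, rfl⟩, hk⟩
        · exact Or.inl ⟨i, hi, hk⟩
        · by_cases h : ∃ a ∈ A, k ∈ N a
          · exact Or.inl h
          · exact Or.inr ⟨b, hb, hk, h⟩
      · rintro (⟨i, hi, hk⟩ | ⟨b, hb, hk, -⟩)
        · exact ⟨i, Or.inl hi, hk⟩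
        · exact ⟨b, Or.inr ⟨b, hb, rfl⟩, hk⟩
    have hle := Finset.card_union_le (A.biUnion N) (S.biUnion fun i => N i \ A.biUnion N)
    have hACcard := Finset.card_union_of_disjoint hAC
    rw [← hunion] at hle
    by_cases hdC : d ∈ C
    · have hfull : (A ∪ C).biUnion N = Finset.univ :=
        Finset.eq_univ_of_forall fun k =>
          Finset.mem_biUnion.2 ⟨d, Finset.mem_union_right _ hdC, by simp [hd]⟩
      have := Finset.card_le_univ (A ∪ C)
      rw [hfull, Finset.card_univ] at hle
      omega
    · have := hmax (A ∪ C) (Finset.mem_powerset.2 fun x hx => Finset.mem_erase.2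
        ⟨fun h => by subst h; exact (Finset.mem_union.1 hx).elim hdA hdC, Finset.mem_univ _⟩)
      omega
  obtain ⟨f, hinj, hf⟩ := (Finset.all_card_le_biUnion_card_iff_exists_injective _).1 hall
  refine ⟨A, f, hdA, hinj, fun i => ⟨(Finset.mem_sdiff.1 (hf i)).1, fun j hj hk => ?_⟩⟩
  exact (Finset.mem_sdiff.1 (hf i)).2 (Finset.mem_biUnion.2 ⟨j, hj, hk⟩)

/-- If every agent values all the objects at `2 n - 2` times its threshold or more, each single
object at no more than its threshold, and one agent `d` knows `n` disjoint bundles that each meet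
its threshold, then disjoint bundles satisfy all `n` agents. -/
lemma exists_disjoint_bundles_of_divider {α ι : Type*} [Fintype α] [DecidableEq α] [Fintype ι]
    [DecidableEq ι] {w : ι → α → ℝ} {t : ι → ℝ} (ht : ∀ i, 0 ≤ t i) (hwt : ∀ i a, w i a ≤ t i)
    (htotal : ∀ i, (2 * (Fintype.card ι : ℝ) - 2) * t i ≤ ∑ a, w i a) (d : ι)
    {Q : ι → Finset α} (hQ : ∀ i j, i ≠ j → Disjoint (Q i) (Q j))
    (hdQ : ∀ k, t d ≤ ∑ a ∈ Q k, w d a) :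
    ∃ Z : ι → Finset α, (∀ i j, i ≠ j → Disjoint (Z i) (Z j)) ∧
      ∀ i, t i ≤ ∑ a ∈ Z i, w i a := by
  obtain ⟨A, f, hdA, hinj, hf⟩ := exists_envy_free_matching le_rfl
    (fun i => Finset.univ.filter fun k => t i ≤ ∑ a ∈ Q k, w i a) d (by simpa using hdQ)
  simp only [Finset.mem_filter, Finset.mem_univ, true_and, not_le] at hf
  set G : Finset α := Finset.univ.biUnion fun i => Q (f i) with hG
  have hfcard : Fintype.card {i // i ∉ A} + A.card = Fintype.card ι := by
    rw [Fintype.card_subtype_compl, Fintype.card_coe]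
    exact Nat.sub_add_cancel (Finset.card_le_univ A)
  have hpos : 1 ≤ Fintype.card {i // i ∉ A} := Fintype.card_pos_iff.2 ⟨⟨d, hdA⟩⟩
  have hGsum : ∀ j ∈ A, ∑ a ∈ G, w j a ≤ Fintype.card {i // i ∉ A} * t j := fun j hj => by
    rw [hG, Finset.sum_biUnion fun x _ y _ hxy => hQ _ _ (hinj.ne hxy)]
    simpa using Finset.sum_le_card_nsmul Finset.univ (fun i => ∑ a ∈ Q (f i), w j a) (t j)
      fun i _ => ((hf i).2 j hj).le
  obtain ⟨Z, hZdisj, hZG, hZ⟩ := exists_bag_filling ht hwt A Gᶜ (fun j hj => by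
    have hsplit := Finset.sum_add_sum_compl G (w j)
    have hcast : (Fintype.card ι : ℝ) = Fintype.card {i // i ∉ A} + A.card := by
      exact_mod_cast hfcard.symm
    have hpos' : (1 : ℝ) ≤ Fintype.card {i // i ∉ A} := by exact_mod_cast hpos
    have htot := htotal j
    rw [hcast] at htot
    nlinarith [hGsum j hj, mul_nonneg (sub_nonneg.2 hpos') (ht j)])
  have hQZ : ∀ i j, Disjoint (Q (f i)) (Z j) := fun i j =>
    Finset.disjoint_of_subset_left
      (Finset.subset_biUnion_of_mem (fun i => Q (f i)) (Finset.mem_univ i))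
      (Finset.disjoint_of_subset_right (hZG j) disjoint_compl_right)
  refine ⟨fun i => if h : i ∉ A then Q (f ⟨i, h⟩) else Z i, fun i j hij => ?_, fun i => ?_⟩
  · by_cases hi : i ∈ A <;> by_cases hj : j ∈ A
    · simpa [hi, hj] using hZdisj i hi j hj hij
    · simpa [hi, hj] using (hQZ ⟨j, hj⟩ i).symm
    · simpa [hi, hj] using hQZ ⟨i, hi⟩ j
    · simpa [hi, hj] using hQ _ _ (hinj.ne fun h => hij (Subtype.ext_iff.1 h))
  · by_cases hi : i ∈ A
    · simpa [hi] using hZ i hi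
    · simpa [hi] using (hf ⟨i, hi⟩).1

/-- An additive set function is the sum of its values on singletons. -/
lemma eq_sum_singleton_of_additive {α : Type*} [DecidableEq α] {V : Finset α → ℝ}
    (hadd : ∀ A B, Disjoint A B → V (A ∪ B) = V A + V B) (A : Finset α) :
    V A = ∑ a ∈ A, V {a} := by
  induction A using Finset.induction_on with
  | empty => simpa using hadd ∅ ∅ (Finset.disjoint_empty_left _)
  | insert a s ha ih =>
    rw [Finset.sum_insert ha, ← ih, ← hadd _ _ (by simpa using ha)]
    rfl

/-- Disjoint bundles can be enlarged to a partition. -/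
lemma exists_partition_superset {α ι : Type*} [Fintype α] [DecidableEq α] [Fintype ι]
    [DecidableEq ι] [Nonempty ι] {Z : ι → Finset α} (hZ : ∀ i j, i ≠ j → Disjoint (Z i) (Z j)) :
    ∃ Y : ι → Finset α, (∀ i j, i ≠ j → Disjoint (Y i) (Y j)) ∧
      Finset.univ.biUnion Y = Finset.univ ∧ ∀ i, Z i ⊆ Y i := by
  obtain ⟨d⟩ := ‹Nonempty ι›
  have hrest : ∀ j, Disjoint (Finset.univ.biUnion Z)ᶜ (Z j) := fun j =>
    Finset.disjoint_of_subset_right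
      (Finset.subset_biUnion_of_mem Z (Finset.mem_univ j)) disjoint_compl_left
  refine ⟨Function.update Z d (Z d ∪ (Finset.univ.biUnion Z)ᶜ), fun i j hij => ?_, ?_,
    fun i => ?_⟩
  · by_cases hi : i = d
    · subst hi
      rw [Function.update_self, Function.update_of_ne hij.symm]
      exact Finset.disjoint_union_left.2 ⟨hZ _ _ hij, hrest j⟩
    by_cases hj : j = d
    · subst hj
      rw [Function.update_self, Function.update_of_ne hij]
      exact Finset.disjoint_union_right.2 ⟨hZ _ _ hij, (hrest i).symm⟩
    · simpa [hi, hj] using hZ i j hij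
  · refine Finset.eq_univ_of_forall fun a => Finset.mem_biUnion.2 ?_
    by_cases ha : a ∈ Finset.univ.biUnion Z
    · obtain ⟨i, -, hi⟩ := Finset.mem_biUnion.1 ha
      refine ⟨i, Finset.mem_univ i, ?_⟩
      by_cases hid : i = d
      · subst hid
        simp [hi]
      · simpa [hid] using hi
    · exact ⟨d, Finset.mem_univ d, by
        rw [Function.update_self]
        exact Finset.mem_union_right _ (Finset.mem_compl.2 ha)⟩
  · by_cases hi : i = d
    · subst hi
      simp
    · simp [hi]

/-- for `n ≥ 2` agents with nonnegative additive valuations over a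
finite set of objects, there is a partition of all the objects into `n` bundles
giving each agent `i` at least its 1-out-of-(2n-2) maximin share. -/
theorem exists_one_out_of_two_n_sub_two_MMS_allocation
    {α : Type*} [Fintype α] [DecidableEq α] (n : ℕ) (hn : 2 ≤ n)
    (Val : Fin n → Finset α → ℝ)
    (hnonneg : ∀ i A, 0 ≤ Val i A)
    (hadd : ∀ i A B, Disjoint A B → Val i (A ∪ B) = Val i A + Val i B) :
    ∃ Z : Fin n → Finset α,
      (∀ i j, i ≠ j → Disjoint (Z i) (Z j)) ∧
      Finset.univ.biUnion Z = Finset.univ ∧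
      ∀ i, MMS (Val i) 1 (2 * n - 2) ≤ Val i (Z i) := by
  have hd : 0 < 2 * n - 2 := by omega
  have hmms := fun i => MMS_one_attained (hnonneg i) hd
  choose ht P hPdisj hPcover hP using hmms
  have hsum := fun i => eq_sum_singleton_of_additive (hadd i)
  have hw := fun i => exists_weight_le_sum_part_eq (v := fun a => Val i {a})
    (fun a => hnonneg i {a}) (ht i) (hPdisj i) (hPcover i)
    (fun k => (hP i k).trans_eq (hsum i _))
  choose w hw0 hwv hwP using hw
  have hwt : ∀ i a, w i a ≤ MMS (Val i) 1 (2 * n - 2) := fun i a => by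
    have ha := Finset.mem_univ a
    rw [← hPcover i] at ha
    obtain ⟨k, -, hk⟩ := Finset.mem_biUnion.1 ha
    rw [← hwP i k]
    exact Finset.single_le_sum (fun b _ => hw0 i b) hk
  have htotal : ∀ i, (2 * (Fintype.card (Fin n) : ℝ) - 2) * MMS (Val i) 1 (2 * n - 2) ≤
      ∑ a, w i a := fun i => by
    rw [← hPcover i, Finset.sum_biUnion fun x _ y _ hxy => hPdisj i x y hxy,
      Finset.sum_congr rfl fun k _ => hwP i k]
    simp [Nat.cast_sub (show 2 ≤ 2 * n by omega)]
  let e : Fin n ↪ Fin (2 * n - 2) := Fin.castLEEmb (by omega)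
  let d : Fin n := ⟨0, by omega⟩
  have : Nonempty (Fin n) := ⟨d⟩
  obtain ⟨Z, hZdisj, hZ⟩ := exists_disjoint_bundles_of_divider ht hwt htotal d
    (Q := fun k => P d (e k)) (fun i j hij => hPdisj d _ _ (e.injective.ne hij))
    (fun k => (hwP d _).ge)
  obtain ⟨Y, hYdisj, hYcover, hZY⟩ := exists_partition_superset hZdisj
  refine ⟨Y, hYdisj, hYcover, fun i => (hZ i).trans ?_⟩
  rw [hsum i (Y i)]
  exact (Finset.sum_le_sum fun a _ => hwv i a).trans
    (Finset.sum_le_sum_of_subset_of_nonneg (hZY i) fun a _ _ => hnonneg i {a})
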